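/- The number of connected endofunctions on {1,...,n} of girth m with at least k records depends only on the sum m + k. In particular, the number of rooted labeled trees on {1,...,n} with at least k records equals the number of connected endofunctions on {1,...,n} of girth k. -/

import Mathlib

def IsTreeFun {n : ℕ} (f : Fin n → Fin n) : Prop :=
  ∃ r, f r = r ∧ ∀ v, ∃ k, f^[k] v = r

def IsRec {n : ℕ} (f : Fin n → Fin n) (v : Fin n) : Prop :=
  ∀ k, f^[k] v ≤ v

def ConnFun {n : ℕ} (f : Fin n → Fin n) : Prop :=
  Nonempty (Fin n) ∧ ∀ i j, Relation.EqvGen (fun a b => f a = b) i j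

noncomputable def girth {n : ℕ} (f : Fin n → Fin n) : ℕ :=
  Nat.card {x : Fin n // ∃ m, 0 < m ∧ f^[m] x = x}

noncomputable def numRec {n : ℕ} (f : Fin n → Fin n) : ℕ :=
  Nat.card {v : Fin n // IsRec f v}

namespace Endofunction

open Function

section Reach

variable {α : Type*} {f : α → α} {u v w : α}

/-- `v` lies in the forward orbit of `u` under `f`. -/
def Reach (f : α → α) (u v : α) : Prop := ∃ j, f^[j] u = v

lemma Reach.refl (f : α → α) (u : α) : Reach f u u := ⟨0, rfl⟩

lemma reach_iterate (f : α → α) (j : ℕ) (u : α) : Reach f u (f^[j] u) := ⟨j, rfl⟩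

lemma Reach.head (h : Reach f (f u) v) : Reach f u v := by
  obtain ⟨j, h⟩ := h
  exact ⟨j + 1, by rwa [iterate_succ_apply]⟩

lemma Reach.head_of_eq {x : α} (e : f u = x) (h : Reach f x v) : Reach f u v :=
  Reach.head (e ▸ h)

lemma Reach.trans (h : Reach f u v) (h' : Reach f v w) : Reach f u w := by
  obtain ⟨j, rfl⟩ := h
  obtain ⟨k, rfl⟩ := h'
  exact ⟨k + j, iterate_add_apply _ _ _ _⟩

lemma Reach.tail (h : Reach f u v) : Reach f u (f v) :=
  h.trans ⟨1, rfl⟩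

lemma Reach.cases_head (h : Reach f u v) : u = v ∨ Reach f (f u) v := by
  obtain ⟨_ | j, h⟩ := h
  · exact Or.inl h
  · exact Or.inr ⟨j, by rwa [iterate_succ_apply] at h⟩

lemma Reach.head_induction {P : α → Prop} (h : Reach f u v) (h₀ : P v)
    (hs : ∀ u, P (f u) → P u) : P u := by
  obtain ⟨j, h⟩ := h
  induction j generalizing u with
  | zero => exact (show u = v from h) ▸ h₀
  | succ j ih => exact hs u (ih (by rwa [iterate_succ_apply] at h))

lemma Reach.mem {P : α → Prop} (h : Reach f u v) (h₀ : P u)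
    (hs : ∀ u, P u → P (f u)) : P v := by
  obtain ⟨j, rfl⟩ := h
  induction j with
  | zero => exact h₀
  | succ j ih => rw [iterate_succ_apply']; exact hs _ ih

lemma Reach.total (h : Reach f u v) (h' : Reach f u w) : Reach f v w ∨ Reach f w v := by
  obtain ⟨j, rfl⟩ := h
  obtain ⟨k, rfl⟩ := h'
  rcases le_total j k with h | h
  · exact Or.inl ⟨k - j, by rw [← iterate_add_apply, Nat.sub_add_cancel h]⟩
  · exact Or.inr ⟨j - k, by rw [← iterate_add_apply, Nat.sub_add_cancel h]⟩

lemma mem_periodicPts_iff_reach : v ∈ periodicPts f ↔ Reach f (f v) v := by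
  constructor
  · rintro ⟨_ | k, hk, h⟩
    · exact absurd hk (lt_irrefl 0)
    · exact ⟨k, by rw [← iterate_succ_apply]; exact h⟩
  · rintro ⟨k, h⟩
    exact ⟨k + 1, k.succ_pos, by rw [← iterate_succ_apply] at h; exact h⟩

lemma Reach.symm_of_periodic (h : Reach f u v) (hu : u ∈ periodicPts f) : Reach f v u := by
  refine h.mem (P := fun w => Reach f w u) (Reach.refl f u) fun w hw => ?_
  rcases hw.cases_head with rfl | hw
  · exact mem_periodicPts_iff_reach.1 hu
  · exact hw

lemma Reach.periodic (h : Reach f u v) (hu : u ∈ periodicPts f) : v ∈ periodicPts f :=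
  mem_periodicPts_iff_reach.2 ((h.tail.symm_of_periodic hu).trans h)

lemma exists_reach_periodic [Finite α] (f : α → α) (v : α) :
    ∃ z ∈ periodicPts f, Reach f v z := by
  obtain ⟨i, j, hij, h⟩ := Finite.exists_ne_map_eq_of_infinite fun j : ℕ => f^[j] v
  wlog hlt : i < j generalizing i j
  · exact this j i hij.symm h.symm (by omega)
  refine ⟨f^[i] v, ⟨j - i, by omega, ?_⟩, reach_iterate f i v⟩
  change f^[j - i] (f^[i] v) = f^[i] v
  rw [← iterate_add_apply, Nat.sub_add_cancel hlt.le]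
  exact h.symm

/-- If `f` and `g` agree off a set closed under `f`, then an `f`-orbit follows the `g`-orbit
until it enters that set. -/
lemma iterate_eq_or_mem {g : α → α} {S : Set α} (hS : ∀ v ∈ S, f v ∈ S)
    (hfg : ∀ v ∉ S, f v = g v) (j : ℕ) (v : α) : f^[j] v = g^[j] v ∨ f^[j] v ∈ S := by
  induction j with
  | zero => exact Or.inl rfl
  | succ j ih =>
    rw [iterate_succ_apply', iterate_succ_apply']
    by_cases h : f^[j] v ∈ S
    · exact Or.inr (hS _ h)
    · left
      rw [hfg _ h, ih.resolve_right h]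

lemma iterate_eq_of_eqOn {g : α → α} {S : Set α} (hS : ∀ v ∈ S, g v ∈ S)
    (hfg : ∀ v ∈ S, f v = g v) (j : ℕ) (hv : v ∈ S) : f^[j] v = g^[j] v ∧ g^[j] v ∈ S := by
  induction j with
  | zero => exact ⟨rfl, hv⟩
  | succ j ih =>
    rw [iterate_succ_apply', iterate_succ_apply', ih.1]
    exact ⟨hfg _ ih.2, hS _ ih.2⟩

lemma Reach.congr {g : α → α} {S : Set α} (hS : ∀ v ∈ S, g v ∈ S)
    (hfg : ∀ v ∈ S, f v = g v) (hu : u ∈ S) : Reach f u v ↔ Reach g u v :=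
  exists_congr fun j => by rw [(iterate_eq_of_eqOn hS hfg j hu).1]

end Reach

variable {n : ℕ} {f g F : Fin n → Fin n} {M y c p u v : Fin n}

lemma _root_.IsRec.le (h : IsRec f u) (huv : Reach f u v) : v ≤ u := by
  obtain ⟨j, rfl⟩ := huv
  exact h j

/-- The maximum of an orbit is a record. -/
lemma exists_isRec_reach (f : Fin n → Fin n) (v : Fin n) :
    ∃ w, Reach f v w ∧ IsRec f w ∧ v ≤ w := by
  obtain ⟨w, hw, hmax⟩ := Set.exists_max_image {w | Reach f v w} id (Set.toFinite _)
    ⟨v, Reach.refl f v⟩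
  exact ⟨w, hw, fun k => hmax _ (hw.trans (reach_iterate f k w)), hmax v (Reach.refl f v)⟩

lemma connFun_of_reach (h : ∀ v, Reach f v p) : ConnFun f := by
  have key : ∀ v, Relation.EqvGen (fun a b => f a = b) v p := fun v =>
    (h v).head_induction (P := fun v => Relation.EqvGen (fun a b => f a = b) v p)
      (.refl _) fun u hu => .trans _ _ _ (.rel _ _ rfl) hu
  exact ⟨⟨p⟩, fun i j => .trans _ _ _ (key i) (.symm _ _ (key j))⟩

lemma _root_.ConnFun.exists_common (h : ConnFun f) (u v : Fin n) :
    ∃ w, Reach f u w ∧ Reach f v w := by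
  induction h.2 u v with
  | rel a b hab => exact ⟨b, ⟨1, hab⟩, .refl f b⟩
  | refl a => exact ⟨a, .refl f a, .refl f a⟩
  | symm a b _ ih => exact ih.imp fun _ h => h.symm
  | trans a b d _ _ ih₁ ih₂ =>
    obtain ⟨w₁, ha, hb⟩ := ih₁
    obtain ⟨w₂, hb', hd⟩ := ih₂
    rcases hb.total hb' with h | h
    · exact ⟨w₂, ha.trans h, hd⟩
    · exact ⟨w₁, ha, hd.trans h⟩

lemma _root_.ConnFun.reach (h : ConnFun f) (hv : v ∈ periodicPts f) (u : Fin n) : Reach f u v := by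
  obtain ⟨w, hu, hw⟩ := h.exists_common u v
  exact hu.trans (hw.symm_of_periodic hv)

/-- In a connected endofunction the maximum of the cycle is the least record. -/
lemma _root_.ConnFun.exists_least_isRec (h : ConnFun f) :
    ∃ c ∈ periodicPts f, IsLeast {v | IsRec f v} c := by
  obtain ⟨v₀⟩ := h.1
  obtain ⟨z, hz, -⟩ := exists_reach_periodic f v₀
  obtain ⟨c, hzc, hc, -⟩ := exists_isRec_reach f z
  have hcp := hzc.periodic hz
  exact ⟨c, hcp, hc, fun v hv => IsRec.le hv (h.reach hcp v)⟩

lemma _root_.ConnFun.one_le_numRec (h : ConnFun f) : 1 ≤ numRec f := by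
  obtain ⟨c, -, hc, -⟩ := h.exists_least_isRec
  have : Nonempty {v : Fin n // IsRec f v} := ⟨⟨c, hc⟩⟩
  exact Nat.card_pos

lemma girth_eq_ncard (f : Fin n → Fin n) : girth f = (periodicPts f).ncard := rfl

lemma numRec_eq_ncard (f : Fin n → Fin n) : numRec f = {v | IsRec f v}.ncard := rfl

lemma isTreeFun_iff : IsTreeFun f ↔ ConnFun f ∧ girth f = 1 := by
  rw [girth_eq_ncard, Set.ncard_eq_one]
  constructor
  · rintro ⟨r, hr, h⟩
    refine ⟨connFun_of_reach h, r, Set.eq_singleton_iff_unique_mem.2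
      ⟨mem_periodicPts_iff_reach.2 ⟨0, hr⟩, fun v hv => ?_⟩⟩
    exact (Reach.symm_of_periodic (h v) hv).mem (P := fun w => w = r) rfl
      fun u hu => by rw [hu, hr]
  · rintro ⟨hf, r, hr⟩
    have hrp : r ∈ periodicPts f := by rw [hr]; rfl
    refine ⟨r, ?_, hf.reach hrp⟩
    have : f r ∈ periodicPts f := (Reach.refl f r).tail.periodic hrp
    rwa [hr] at this

/-- The vertices whose `F`-orbit stays strictly below `M`. -/
def below (F : Fin n → Fin n) (M : Fin n) : Set (Fin n) := {v | ∀ j, F^[j] v < M}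

lemma lt_of_mem_below (hv : v ∈ below F M) : v < M := hv 0

lemma map_mem_below (hv : v ∈ below F M) : F v ∈ below F M :=
  fun j => by rw [← iterate_succ_apply]; exact hv (j + 1)

lemma Reach.mem_below (h : Reach F u v) (hu : u ∈ below F M) : v ∈ below F M :=
  h.mem hu fun _ => map_mem_below

lemma self_notMem_below : M ∉ below F M := fun h => lt_irrefl M (h 0)

lemma not_reach_of_mem_below (hv : v ∈ below F M) : ¬ Reach F v M :=
  fun h => self_notMem_below (h.mem_below hv)

lemma le_of_isRec_of_notMem_below (h : IsRec F v) (hv : v ∉ below F M) : M ≤ v := by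
  simp only [below, Set.mem_ofPred_eq, not_forall, not_lt] at hv
  obtain ⟨j, hj⟩ := hv
  exact hj.trans (h j)

/-- An endofunction `F` fixing `M`, with a marked vertex `y` in `below F M`, the maximum `c` of
`below F M`, and a cyclic vertex `p` of `below F M`, such that every vertex reaches `M` or `p`. -/
structure IsMarked (F : Fin n → Fin n) (M y c p : Fin n) : Prop where
  fix : F M = M
  mark_mem : y ∈ below F M
  max : IsGreatest (below F M) c
  cyc_mem : p ∈ below F M
  cyc : p ∈ periodicPts F
  reach : ∀ v, Reach F v M ∨ Reach F v p

namespace IsMarked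

lemma reach_of_mem (h : IsMarked F M y c p) (hv : v ∈ below F M) : Reach F v p :=
  (h.reach v).resolve_left (not_reach_of_mem_below hv)

lemma mem_below_of_periodic (h : IsMarked F M y c p) (hv : v ∈ periodicPts F) (hM : v ≠ M) :
    v ∈ below F M := by
  rcases h.reach v with hr | hr
  · exact absurd ((hr.symm_of_periodic hv).mem (P := fun w => w = M) rfl
      fun u hu => by rw [hu, h.fix]) hM
  · exact (hr.symm_of_periodic hv).mem_below h.cyc_mem

lemma self_mem_periodicPts (h : IsMarked F M y c p) : M ∈ periodicPts F :=
  mem_periodicPts_iff_reach.2 ⟨0, h.fix⟩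

lemma isRec_self (h : IsMarked F M y c p) : IsRec F M := fun j => by
  rw [iterate_fixed h.fix]

end IsMarked

/-- Records outside `below F M` do not change when `F` is modified inside
`insert M (below F M)`, as long as this set stays closed. -/
lemma isRec_iff_of_eq_off (hM : F M = M)
    (hg : ∀ u ∈ insert M (below F M), g u ∈ insert M (below F M))
    (hgF : ∀ u ∉ insert M (below F M), g u = F u) (hv : v ∉ below F M) :
    IsRec g v ↔ IsRec F v := by
  have hF : ∀ u ∈ insert M (below F M), F u ∈ insert M (below F M) := by
    rintro u (rfl | hu)
    · exact Or.inl hM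
    · exact Or.inr (map_mem_below hu)
  have le_of_mem : ∀ {w}, w ∈ insert M (below F M) → w ≤ M := by
    rintro w (rfl | hw)
    · exact le_rfl
    · exact (lt_of_mem_below hw).le
  constructor <;> intro h
  · have hMv : M ≤ v := by
      by_contra hlt
      refine hv fun j => ?_
      rcases iterate_eq_or_mem hF (fun u hu => (hgF u hu).symm) j v with e | e | e
      · exact e ▸ (h j).trans_lt (not_le.1 hlt)
      · refine absurd (h.le ?_) hlt
        refine (Reach.head_induction (f := F) (P := fun u => Reach F u M ∧ Reach g u M)
          ⟨j, e⟩ ⟨Reach.refl _ _, Reach.refl _ _⟩ fun u hu => ⟨hu.1.head, ?_⟩).2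
        by_cases hm : u ∈ insert M (below F M)
        · rcases hm with rfl | hm
          · exact Reach.refl _ _
          · exact absurd hu.1.head (not_reach_of_mem_below hm)
        · exact Reach.head_of_eq (hgF u hm) hu.2
      · exact lt_of_mem_below e
    intro j
    rcases iterate_eq_or_mem hF (fun u hu => (hgF u hu).symm) j v with e | e
    · exact e ▸ h j
    · exact (le_of_mem e).trans hMv
  · intro j
    rcases iterate_eq_or_mem hg hgF j v with e | e
    · exact e ▸ h j
    · exact (le_of_mem e).trans (le_of_isRec_of_notMem_below h hv)

section ConjSwap

open Classical in
/-- Conjugate `F` by the transposition `(c y)` inside `below F M`. -/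
noncomputable def conjSwap (F : Fin n → Fin n) (M y c : Fin n) : Fin n → Fin n := fun v =>
  if v ∈ below F M then Equiv.swap c y (F (Equiv.swap c y v)) else F v

lemma conjSwap_of_mem (hv : v ∈ below F M) :
    conjSwap F M y c v = Equiv.swap c y (F (Equiv.swap c y v)) := if_pos hv

lemma conjSwap_of_notMem (hv : v ∉ below F M) : conjSwap F M y c v = F v := if_neg hv

variable (hy : y ∈ below F M) (hc : c ∈ below F M)
include hy hc

lemma swap_mem_below (hv : v ∈ below F M) : Equiv.swap c y v ∈ below F M := by
  rw [Equiv.swap_apply_def]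
  split_ifs <;> assumption

lemma conjSwap_mem (hv : v ∈ below F M) : conjSwap F M y c v ∈ below F M := by
  rw [conjSwap_of_mem hv]
  exact swap_mem_below hy hc (map_mem_below (swap_mem_below hy hc hv))

lemma iterate_conjSwap (hv : v ∈ below F M) (j : ℕ) :
    (conjSwap F M y c)^[j] (Equiv.swap c y v) = Equiv.swap c y (F^[j] v) := by
  induction j with
  | zero => rfl
  | succ j ih =>
    rw [iterate_succ_apply', iterate_succ_apply', ih, conjSwap_of_mem
      (swap_mem_below hy hc ((reach_iterate F j v).mem_below hv)), Equiv.swap_apply_self]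

lemma below_conjSwap : below (conjSwap F M y c) M = below F M := by
  ext v
  constructor
  · intro h
    by_contra hv
    obtain ⟨j, hj⟩ : ∃ j, M ≤ F^[j] v := by simpa [below] using hv
    rcases iterate_eq_or_mem (f := F) (g := conjSwap F M y c) (S := below F M)
      (fun _ => map_mem_below) (fun v hv => (conjSwap_of_notMem hv).symm) j v with e | hm
    · exact (h j).not_ge (e ▸ hj)
    · exact (lt_of_mem_below hm).not_ge hj
  · intro hv j
    exact lt_of_mem_below (Reach.mem (reach_iterate _ j v) (P := (· ∈ below F M)) hv
      fun u hu => conjSwap_mem hy hc hu)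

lemma conjSwap_conjSwap : conjSwap (conjSwap F M y c) M y c = F := by
  have hb := below_conjSwap hy hc
  funext v
  by_cases hv : v ∈ below F M
  · rw [conjSwap_of_mem (hb ▸ hv), conjSwap_of_mem
      (swap_mem_below hy hc hv), Equiv.swap_apply_self, Equiv.swap_apply_self]
  · rw [conjSwap_of_notMem (hb ▸ hv), conjSwap_of_notMem hv]

lemma reach_conjSwap (hu : u ∈ below F M) (h : Reach F u v) :
    Reach (conjSwap F M y c) (Equiv.swap c y u) (Equiv.swap c y v) := by
  obtain ⟨j, rfl⟩ := h
  exact ⟨j, iterate_conjSwap hy hc hu j⟩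

lemma swap_mem_periodicPts (hu : u ∈ below F M) (h : u ∈ periodicPts F) :
    Equiv.swap c y u ∈ periodicPts (conjSwap F M y c) := by
  rw [mem_periodicPts_iff_reach] at h ⊢
  rw [conjSwap_of_mem (swap_mem_below hy hc hu), Equiv.swap_apply_self]
  exact reach_conjSwap hy hc (map_mem_below hu) h

lemma isRec_conjSwap (hv : v ∉ below F M) (h : IsRec F v) : IsRec (conjSwap F M y c) v := by
  intro j
  rcases iterate_eq_or_mem (fun _ => conjSwap_mem hy hc) (fun _ => conjSwap_of_notMem) j v
    with e | hm
  · exact e ▸ h j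
  · exact (lt_of_mem_below hm).le.trans (le_of_isRec_of_notMem_below h hv)

end ConjSwap

lemma IsMarked.conjSwap (h : IsMarked F M y c p) :
    IsMarked (conjSwap F M y c) M y c (Equiv.swap c y p) := by
  have hy := h.mark_mem
  have hc := h.max.1
  have hb := below_conjSwap hy hc
  refine ⟨?_, hb ▸ hy, hb ▸ h.max, hb ▸ swap_mem_below hy hc h.cyc_mem,
    swap_mem_periodicPts hy hc h.cyc_mem h.cyc, fun v => ?_⟩
  · rw [conjSwap_of_notMem self_notMem_below, h.fix]
  · have key : ∀ u ∈ below F M, Reach (Endofunction.conjSwap F M y c) u (Equiv.swap c y p) := by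
      intro u hu
      have := reach_conjSwap hy hc (swap_mem_below hy hc hu)
        (h.reach_of_mem (swap_mem_below hy hc hu))
      rwa [Equiv.swap_apply_self] at this
    let P : Fin n → Prop := fun u => Reach (Endofunction.conjSwap F M y c) u M ∨
      Reach (Endofunction.conjSwap F M y c) u (Equiv.swap c y p)
    have step : ∀ u, P (F u) → P u := by
      intro u hu
      by_cases hm : u ∈ below F M
      · exact Or.inr (key u hm)
      · have e := conjSwap_of_notMem (y := y) (c := c) hm
        exact hu.imp (Reach.head_of_eq e) (Reach.head_of_eq e)
    rcases h.reach v with hr | hr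
    · exact hr.head_induction (P := P) (Or.inl (Reach.refl _ _)) step
    · exact hr.head_induction (P := P) (Or.inr (key p h.cyc_mem)) step

/-- The number of records outside `below F M`. -/
noncomputable def numRecOff (F : Fin n → Fin n) (M : Fin n) : ℕ :=
  {v | v ∉ below F M ∧ IsRec F v}.ncard

namespace IsMarked

lemma ncard_periodicPts_conjSwap_le (h : IsMarked F M y c p) :
    (periodicPts F).ncard ≤ (periodicPts (Endofunction.conjSwap F M y c)).ncard := by
  refine Set.ncard_le_ncard_of_injOn (Equiv.swap c y) (fun v hv => ?_)
    (Equiv.injective _).injOn (Set.toFinite _)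
  by_cases hM : v = M
  · subst hM
    rw [Equiv.swap_apply_of_ne_of_ne (lt_of_mem_below h.max.1).ne' (lt_of_mem_below h.mark_mem).ne']
    exact h.conjSwap.self_mem_periodicPts
  · exact swap_mem_periodicPts h.mark_mem h.max.1 (h.mem_below_of_periodic hv hM) hv

lemma ncard_periodicPts_conjSwap (h : IsMarked F M y c p) :
    (periodicPts (Endofunction.conjSwap F M y c)).ncard = (periodicPts F).ncard := by
  refine le_antisymm ?_ h.ncard_periodicPts_conjSwap_le
  have := h.conjSwap.ncard_periodicPts_conjSwap_le
  rwa [conjSwap_conjSwap h.mark_mem h.max.1] at this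

lemma numRecOff_conjSwap_ge (h : IsMarked F M y c p) :
    numRecOff F M ≤ numRecOff (Endofunction.conjSwap F M y c) M := by
  refine Set.ncard_le_ncard (fun v hv => ⟨?_, ?_⟩) (Set.toFinite _)
  · rw [below_conjSwap h.mark_mem h.max.1]
    exact hv.1
  · exact isRec_conjSwap h.mark_mem h.max.1 hv.1 hv.2

lemma numRecOff_conjSwap (h : IsMarked F M y c p) :
    numRecOff (Endofunction.conjSwap F M y c) M = numRecOff F M := by
  refine le_antisymm ?_ h.numRecOff_conjSwap_ge
  have := h.conjSwap.numRecOff_conjSwap_ge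
  rwa [conjSwap_conjSwap h.mark_mem h.max.1] at this

end IsMarked

/-! ### Joining the two components by redirecting the fixed point -/

/-- Redirect the fixed point `M` to the marked vertex `y`. -/
def attach (F : Fin n → Fin n) (M y : Fin n) : Fin n → Fin n := Function.update F M y

lemma attach_self : attach F M y M = y := Function.update_self ..

lemma attach_of_ne (h : v ≠ M) : attach F M y v = F v := Function.update_of_ne h ..

lemma attach_of_mem (h : v ∈ below F M) : attach F M y v = F v :=
  attach_of_ne (lt_of_mem_below h).ne

namespace IsMarked

lemma reach_attach_iff (hu : u ∈ below F M) : Reach (attach F M y) u v ↔ Reach F u v :=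
  Reach.congr (fun _ => map_mem_below) (fun _ => attach_of_mem) hu

lemma reach_attach (h : IsMarked F M y c p) (v : Fin n) : Reach (attach F M y) v p := by
  have hb : ∀ u ∈ below F M, Reach (attach F M y) u p := fun u hu =>
    (reach_attach_iff hu).2 (h.reach_of_mem hu)
  have hM : Reach (attach F M y) M p := Reach.head_of_eq attach_self (hb y h.mark_mem)
  have step : ∀ u, Reach (attach F M y) (F u) p → Reach (attach F M y) u p := by
    intro u hu
    by_cases e : u = M
    · exact e ▸ hM
    · exact Reach.head_of_eq (attach_of_ne e) hu
  rcases h.reach v with hr | hr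
  · exact hr.head_induction (P := fun u => Reach (attach F M y) u p) hM step
  · exact hr.head_induction (P := fun u => Reach (attach F M y) u p) (Reach.refl _ _) step

lemma connFun_attach (h : IsMarked F M y c p) : ConnFun (attach F M y) :=
  connFun_of_reach h.reach_attach

lemma mem_periodicPts_attach (h : IsMarked F M y c p) : p ∈ periodicPts (attach F M y) := by
  rw [mem_periodicPts_iff_reach, attach_of_mem h.cyc_mem,
    reach_attach_iff (map_mem_below h.cyc_mem)]
  exact mem_periodicPts_iff_reach.1 h.cyc

lemma periodicPts_attach (h : IsMarked F M y c p) :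
    periodicPts (attach F M y) = periodicPts F \ {M} := by
  ext v
  constructor
  · intro hv
    have hr := (reach_attach_iff h.cyc_mem).1 ((h.reach_attach v).symm_of_periodic hv)
    exact ⟨hr.periodic h.cyc, (lt_of_mem_below (hr.mem_below h.cyc_mem)).ne⟩
  · rintro ⟨hv, hM⟩
    have hr := (h.reach_of_mem (h.mem_below_of_periodic hv hM)).symm_of_periodic hv
    exact Reach.periodic ((reach_attach_iff h.cyc_mem).2 hr) h.mem_periodicPts_attach

lemma girth_attach (h : IsMarked F M y c p) :
    girth (attach F M y) + 1 = (periodicPts F).ncard := by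
  rw [girth_eq_ncard, h.periodicPts_attach]
  exact Set.ncard_sdiff_singleton_add_one h.self_mem_periodicPts (Set.toFinite _)

lemma isRec_attach_iff (h : IsMarked F M y c p) (hv : v ∉ below F M) :
    IsRec (attach F M y) v ↔ IsRec F v := by
  refine isRec_iff_of_eq_off h.fix ?_ (fun u hu => attach_of_ne fun hM => hu (Or.inl hM)) hv
  rintro u (rfl | hu)
  · exact Or.inr (attach_self (F := F) ▸ h.mark_mem)
  · exact Or.inr (attach_of_mem (y := y) hu ▸ map_mem_below hu)

lemma isRec_attach_max (h : IsMarked F M y c c) : IsRec (attach F M y) c := fun j =>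
  h.max.2 (((reach_attach_iff h.max.1).1 (reach_iterate _ j c)).mem_below h.max.1)

lemma setOf_isRec_attach (h : IsMarked F M y c c) :
    {v | IsRec (attach F M y) v} = insert c {v | v ∉ below F M ∧ IsRec F v} := by
  ext v
  by_cases hv : v ∈ below F M
  · refine ⟨fun hr => Or.inl ?_, ?_⟩
    · exact le_antisymm (h.max.2 hv) (_root_.IsRec.le hr (h.reach_attach v))
    · rintro (rfl | hr)
      · exact h.isRec_attach_max
      · exact absurd hv hr.1
  · refine (h.isRec_attach_iff hv).trans ⟨fun hr => Or.inr ⟨hv, hr⟩, ?_⟩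
    rintro (rfl | hr)
    · exact absurd h.max.1 hv
    · exact hr.2

lemma numRec_attach (h : IsMarked F M y c c) :
    numRec (attach F M y) = numRecOff F M + 1 := by
  rw [numRec_eq_ncard, h.setOf_isRec_attach]
  exact Set.ncard_insert_of_notMem (fun hc => hc.1 h.max.1) (Set.toFinite _)

lemma isLeast_isRec_attach (h : IsMarked F M y c c) :
    IsLeast {v | IsRec (attach F M y) v} c := by
  rw [h.setOf_isRec_attach]
  refine ⟨Or.inl rfl, ?_⟩
  rintro v (rfl | hv)
  · exact le_rfl
  · exact (lt_of_mem_below h.max.1).le.trans (le_of_isRec_of_notMem_below hv.2 hv.1)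

lemma isLeast_isRec_attach_gt (h : IsMarked F M y c c) :
    IsLeast {v | IsRec (attach F M y) v ∧ c < v} M := by
  refine ⟨⟨(h.isRec_attach_iff self_notMem_below).2 h.isRec_self, lt_of_mem_below h.max.1⟩, ?_⟩
  rintro v ⟨hr, hlt⟩
  have hv : v ∉ below F M := fun hv => (h.max.2 hv).not_gt hlt
  exact le_of_isRec_of_notMem_below ((h.isRec_attach_iff hv).1 hr) hv

lemma attach_inj {F' : Fin n → Fin n} {M' y' c' : Fin n} (h : IsMarked F M y c c)
    (h' : IsMarked F' M' y' c' c') (e : attach F M y = attach F' M' y') :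
    (F, M, y, c) = (F', M', y', c') := by
  obtain rfl : c = c' := h.isLeast_isRec_attach.unique (e ▸ h'.isLeast_isRec_attach)
  obtain rfl : M = M' := h.isLeast_isRec_attach_gt.unique (e ▸ h'.isLeast_isRec_attach_gt)
  obtain rfl : y = y' := by simpa [attach] using congrFun e M
  obtain rfl : F = F' := by
    funext v
    by_cases hv : v = M
    · rw [hv, h.fix, h'.fix]
    · rw [← attach_of_ne (F := F) (y := y) hv, e, attach_of_ne hv]
  rfl

end IsMarked

lemma exists_isMarked_attach (hf : ConnFun f) (h2 : 2 ≤ numRec f) :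
    ∃ F M y c, IsMarked F M y c c ∧ attach F M y = f := by
  obtain ⟨c, hcp, hc⟩ := hf.exists_least_isRec
  obtain ⟨v, hv, hvc⟩ := Set.exists_ne_of_one_lt_ncard (s := {v | IsRec f v}) h2 c
  obtain ⟨M, ⟨hM, hcM⟩, hmin⟩ := Set.exists_min_image {v | IsRec f v ∧ c < v} id
    (Set.toFinite _) ⟨v, hv, lt_of_le_of_ne (hc.2 hv) hvc.symm⟩
  have hMp : M ∉ periodicPts f := fun h => (hc.1.le (hf.reach h c)).not_gt hcM
  have hF : ∀ {u}, (∀ j, f^[j] u < M) → ∀ j, (Function.update f M M)^[j] u = f^[j] u := by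
    intro u hu j
    induction j with
    | zero => rfl
    | succ j ih =>
      rw [iterate_succ_apply', ih, Function.update_of_ne (hu j).ne, iterate_succ_apply']
  have mem_of : ∀ {u}, (∀ j, f^[j] u < M) → u ∈ below (Function.update f M M) M := by
    intro u hu j
    rw [hF hu]
    exact hu j
  have hcb : ∀ j, f^[j] c < M := fun j => (hc.1 j).trans_lt hcM
  refine ⟨Function.update f M M, M, f M, c, ⟨Function.update_self .., mem_of fun j => ?_,
    ⟨mem_of hcb, fun u hu => ?_⟩, mem_of hcb, ?_, fun v => ?_⟩, ?_⟩
  · rw [← iterate_succ_apply]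
    refine lt_of_le_of_ne (hM _) fun e => hMp ⟨j + 1, j.succ_pos, e⟩
  · have hfu : ∀ j, f^[j] u = (Function.update f M M)^[j] u := fun j =>
      (iterate_eq_of_eqOn (S := below (Function.update f M M) M) (fun _ => map_mem_below)
        (fun w hw => (Function.update_of_ne (lt_of_mem_below hw).ne _ _).symm) j hu).1
    obtain ⟨w, ⟨j, rfl⟩, hw, huw⟩ := exists_isRec_reach f u
    refine huw.trans (not_lt.1 fun hlt => (hmin _ ⟨hw, hlt⟩).not_gt ?_)
    change f^[j] u < M
    rw [hfu]
    exact hu j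
  · obtain ⟨k, hk, e⟩ := hcp
    refine ⟨k, hk, ?_⟩
    change _^[k] c = c
    rw [hF hcb]
    exact e
  · refine (hf.reach hcp v).head_induction
      (P := fun u => Reach (Function.update f M M) u M ∨ Reach (Function.update f M M) u c)
      (Or.inr (Reach.refl _ _)) fun u hu => ?_
    by_cases e : u = M
    · exact Or.inl (e ▸ Reach.refl _ _)
    · have e' : Function.update f M M u = f u := Function.update_of_ne e ..
      exact hu.imp (Reach.head_of_eq e') (Reach.head_of_eq e')
  · rw [attach, Function.update_idem, Function.update_eq_self]

/-! ### Joining the two components by splicing the fixed point into the cycle -/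

/-- Insert the fixed point `M` into the cycle of `F` after `y`. -/
def splice (F : Fin n → Fin n) (M y : Fin n) : Fin n → Fin n := F ∘ Equiv.swap y M

lemma splice_left : splice F M y y = F M := by simp [splice]

lemma splice_right : splice F M y M = F y := by simp [splice]

lemma splice_of_ne (hy : v ≠ y) (hM : v ≠ M) : splice F M y v = F v := by
  simp [splice, Equiv.swap_apply_of_ne_of_ne hy hM]

lemma splice_splice : splice (splice F M y) M y = F := by
  funext v
  simp [splice]

namespace IsMarked

lemma reach_splice (h : IsMarked F M y c y) (v : Fin n) : Reach (splice F M y) v M := by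
  have hy : Reach (splice F M y) y M := ⟨1, splice_left.trans h.fix⟩
  have step : ∀ u, Reach (splice F M y) (F u) M → Reach (splice F M y) u M := by
    intro u hu
    by_cases e : u = M
    · exact e ▸ Reach.refl _ _
    · by_cases e' : u = y
      · exact e' ▸ hy
      · exact Reach.head_of_eq (splice_of_ne e' e) hu
  rcases h.reach v with hr | hr
  · exact hr.head_induction (P := fun u => Reach (splice F M y) u M) (Reach.refl _ _) step
  · exact hr.head_induction (P := fun u => Reach (splice F M y) u M) hy step

lemma connFun_splice (h : IsMarked F M y c y) : ConnFun (splice F M y) :=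
  connFun_of_reach h.reach_splice

lemma mem_periodicPts_splice (h : IsMarked F M y c y) : M ∈ periodicPts (splice F M y) :=
  mem_periodicPts_iff_reach.2 (h.reach_splice _)

lemma periodicPts_splice (h : IsMarked F M y c y) :
    periodicPts (splice F M y) = periodicPts F := by
  have hyp := mem_periodicPts_iff_reach.1 h.cyc
  ext v
  constructor
  · intro hv
    have : v = M ∨ Reach F y v := by
      refine ((h.reach_splice v).symm_of_periodic hv).mem (P := fun w => w = M ∨ Reach F y w)
        (Or.inl rfl) ?_
      rintro u (rfl | hu)
      · exact Or.inr (splice_right (F := F) ▸ (Reach.refl F y).tail)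
      · by_cases e : u = y
        · exact Or.inl (e ▸ splice_left.trans h.fix)
        · have hM : u ≠ M := (lt_of_mem_below (hu.mem_below h.mark_mem)).ne
          exact Or.inr (splice_of_ne (F := F) e hM ▸ hu.tail)
    rcases this with rfl | hr
    · exact h.self_mem_periodicPts
    · exact hr.periodic h.cyc
  · intro hv
    by_cases hM : v = M
    · exact hM ▸ h.mem_periodicPts_splice
    · have hyv := (h.reach_of_mem (h.mem_below_of_periodic hv hM)).symm_of_periodic hv
      have : Reach F (F y) v := hyp.trans hyv
      refine Reach.periodic (u := M) ?_ h.mem_periodicPts_splice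
      refine (this.mem (P := fun w => w ∈ below F M ∧ Reach (splice F M y) M w)
        ⟨map_mem_below h.mark_mem, 1, splice_right⟩ fun u hu => ⟨map_mem_below hu.1, ?_⟩).2
      by_cases e : u = y
      · exact ⟨1, e ▸ splice_right⟩
      · exact splice_of_ne (F := F) e (lt_of_mem_below hu.1).ne ▸ hu.2.tail

lemma girth_splice (h : IsMarked F M y c y) :
    girth (splice F M y) = (periodicPts F).ncard := by
  rw [girth_eq_ncard, h.periodicPts_splice]

lemma isRec_splice_iff (h : IsMarked F M y c y) (hv : v ∉ below F M) :
    IsRec (splice F M y) v ↔ IsRec F v := by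
  refine isRec_iff_of_eq_off h.fix ?_ (fun u hu => splice_of_ne
    (fun e => hu (Or.inr (e ▸ h.mark_mem))) fun e => hu (Or.inl e)) hv
  rintro u (rfl | hu)
  · exact Or.inr (splice_right (F := F) ▸ map_mem_below h.mark_mem)
  · by_cases e : u = y
    · exact Or.inl (e ▸ splice_left.trans h.fix)
    · exact Or.inr (splice_of_ne (F := F) e (lt_of_mem_below hu).ne ▸ map_mem_below hu)

lemma setOf_isRec_splice (h : IsMarked F M y c y) :
    {v | IsRec (splice F M y) v} = {v | v ∉ below F M ∧ IsRec F v} := by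
  ext v
  by_cases hv : v ∈ below F M
  · exact ⟨fun hr => absurd (_root_.IsRec.le hr (h.reach_splice v)) (lt_of_mem_below hv).not_ge,
      fun hr => absurd hv hr.1⟩
  · exact (h.isRec_splice_iff hv).trans ⟨fun hr => ⟨hv, hr⟩, fun hr => hr.2⟩

lemma numRec_splice (h : IsMarked F M y c y) : numRec (splice F M y) = numRecOff F M := by
  rw [numRec_eq_ncard, h.setOf_isRec_splice, numRecOff]

lemma isLeast_isRec_splice (h : IsMarked F M y c y) :
    IsLeast {v | IsRec (splice F M y) v} M := by
  rw [h.setOf_isRec_splice]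
  exact ⟨⟨self_notMem_below, h.isRec_self⟩, fun v hv => le_of_isRec_of_notMem_below hv.2 hv.1⟩

lemma splice_inj {F' : Fin n → Fin n} {M' y' c' : Fin n} (h : IsMarked F M y c y)
    (h' : IsMarked F' M' y' c' y') (e : splice F M y = splice F' M' y') :
    (F, M, y, c) = (F', M', y', c') := by
  obtain rfl : M = M' := h.isLeast_isRec_splice.unique (e ▸ h'.isLeast_isRec_splice)
  obtain rfl : y = y' := by
    have hy : y ∈ periodicPts (splice F M y) := h.periodicPts_splice ▸ h.cyc
    have hy' : y' ∈ periodicPts (splice F M y) := e ▸ h'.periodicPts_splice ▸ h'.cyc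
    refine (bijOn_periodicPts (splice F M y)).injOn hy hy' ?_
    rw [splice_left, h.fix, e, splice_left, h'.fix]
  obtain rfl : F = F' := by
    rw [← splice_splice (F := F) (M := M) (y := y), e, splice_splice]
  obtain rfl : c = c' := h.max.unique h'.max
  rfl

end IsMarked

lemma exists_isMarked_splice (hg : ConnFun g) (h2 : 2 ≤ girth g) :
    ∃ F M y c, IsMarked F M y c y ∧ splice F M y = g := by
  obtain ⟨M, hMp, hM⟩ := hg.exists_least_isRec
  have hinj := (bijOn_periodicPts g).injOn
  have hmap := (bijOn_periodicPts g).mapsTo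
  obtain ⟨y, hyp, hy⟩ := (bijOn_periodicPts g).surjOn hMp
  have hgM : g M ≠ M := by
    intro e
    obtain ⟨v, hv, hvM⟩ := Set.exists_ne_of_one_lt_ncard (s := periodicPts g) h2 M
    exact hvM (((hg.reach hv M)).mem (P := fun w => w = M) rfl fun u hu => by rw [hu, e])
  have hyM : y ≠ M := fun e => hgM (e ▸ hy)
  have hF : ∀ {u}, Reach (splice g M y) y u → u ∈ periodicPts g ∧ u ≠ M := by
    intro u hu
    refine hu.mem (P := fun w => w ∈ periodicPts g ∧ w ≠ M) ⟨hyp, hyM⟩ ?_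
    rintro w ⟨hw, hwM⟩
    by_cases e : w = y
    · rw [e, splice_left]
      exact ⟨hmap hMp, hgM⟩
    · rw [splice_of_ne e hwM]
      exact ⟨hmap hw, fun e' => e (hinj hw hyp (e'.trans hy.symm))⟩
  have hyb : y ∈ below (splice g M y) M := fun j => by
    obtain ⟨hp, hne⟩ := hF (reach_iterate _ j y)
    exact lt_of_le_of_ne (hM.1.le (hg.reach hp M)) hne
  have hr : ∀ v, Reach (splice g M y) v M ∨ Reach (splice g M y) v y := by
    intro v
    refine (hg.reach hMp v).head_induction
      (P := fun u => Reach (splice g M y) u M ∨ Reach (splice g M y) u y)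
      (Or.inl (Reach.refl _ _)) fun u hu => ?_
    by_cases e : u = M
    · exact Or.inl (e ▸ Reach.refl _ _)
    · by_cases e' : u = y
      · exact Or.inr (e' ▸ Reach.refl _ _)
      · exact hu.imp (Reach.head_of_eq (splice_of_ne e' e)) (Reach.head_of_eq (splice_of_ne e' e))
  obtain ⟨c, hc, hmax⟩ := Set.exists_max_image (below (splice g M y) M) id (Set.toFinite _) ⟨y, hyb⟩
  refine ⟨splice g M y, M, y, c, ⟨splice_right.trans hy, hyb, ⟨hc, hmax⟩, hyb, ?_, hr⟩,
    splice_splice⟩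
  exact mem_periodicPts_iff_reach.2 ((hr _).resolve_left
    (not_reach_of_mem_below (map_mem_below hyb)))

/-! ### Counting -/

/-- Connected endofunctions of girth `m` with at least `k` records. -/
def connFuns (n m k : ℕ) : Set (Fin n → Fin n) := {f | ConnFun f ∧ girth f = m ∧ k ≤ numRec f}

/-- Marked functions `(F, M, y, c)` whose distinguished cyclic vertex is selected by `s y c`, with
`m + 1` periodic points and at least `k` records outside `below F M`. -/
def markedFuns (n m k : ℕ) (s : Fin n → Fin n → Fin n) :
    Set ((Fin n → Fin n) × Fin n × Fin n × Fin n) :=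
  {q | IsMarked q.1 q.2.1 q.2.2.1 q.2.2.2 (s q.2.2.1 q.2.2.2) ∧
    (periodicPts q.1).ncard = m + 1 ∧ k ≤ numRecOff q.1 q.2.1}

lemma ncard_markedFuns_max (n m : ℕ) {k : ℕ} (hk : 1 ≤ k) :
    (markedFuns n m k fun _ c => c).ncard = (connFuns n m (k + 1)).ncard := by
  refine Set.ncard_congr (fun q _ => attach q.1 q.2.1 q.2.2.1) ?_ ?_ ?_
  · rintro ⟨F, M, y, c⟩ ⟨h, hm, hN⟩
    refine ⟨h.connFun_attach, ?_, ?_⟩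
    · have := h.girth_attach
      dsimp only at *
      omega
    · rw [h.numRec_attach]
      exact Nat.succ_le_succ hN
  · rintro ⟨F, M, y, c⟩ ⟨F', M', y', c'⟩ ⟨h, -⟩ ⟨h', -⟩ e
    exact h.attach_inj h' e
  · rintro f ⟨hf, hm, hN⟩
    obtain ⟨F, M, y, c, h, rfl⟩ := exists_isMarked_attach hf (by omega)
    refine ⟨(F, M, y, c), ⟨h, ?_, ?_⟩, rfl⟩
    · rw [← hm, h.girth_attach]
    · rw [h.numRec_attach] at hN
      exact Nat.le_of_succ_le_succ hN

lemma ncard_markedFuns_mark (n k : ℕ) {m : ℕ} (hm : 1 ≤ m) :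
    (markedFuns n m k fun y _ => y).ncard = (connFuns n (m + 1) k).ncard := by
  refine Set.ncard_congr (fun q _ => splice q.1 q.2.1 q.2.2.1) ?_ ?_ ?_
  · rintro ⟨F, M, y, c⟩ ⟨h, hm, hN⟩
    exact ⟨h.connFun_splice, h.girth_splice.trans hm, hN.trans_eq h.numRec_splice.symm⟩
  · rintro ⟨F, M, y, c⟩ ⟨F', M', y', c'⟩ ⟨h, -⟩ ⟨h', -⟩ e
    exact h.splice_inj h' e
  · rintro f ⟨hf, hm, hN⟩
    obtain ⟨F, M, y, c, h, rfl⟩ := exists_isMarked_splice hf (by omega)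
    exact ⟨(F, M, y, c), ⟨h, h.girth_splice.symm.trans hm, hN.trans_eq h.numRec_splice⟩, rfl⟩

lemma conjSwap_mem_markedFuns {m k : ℕ} {s t : Fin n → Fin n → Fin n}
    (hst : ∀ y c, Equiv.swap c y (s y c) = t y c) {q : (Fin n → Fin n) × Fin n × Fin n × Fin n}
    (hq : q ∈ markedFuns n m k s) :
    (conjSwap q.1 q.2.1 q.2.2.1 q.2.2.2, q.2) ∈ markedFuns n m k t :=
  ⟨hst _ _ ▸ hq.1.conjSwap, hq.1.ncard_periodicPts_conjSwap.trans hq.2.1,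
    hq.2.2.trans_eq hq.1.numRecOff_conjSwap.symm⟩

lemma ncard_markedFuns_comm (n m k : ℕ) :
    (markedFuns n m k fun _ c => c).ncard = (markedFuns n m k fun y _ => y).ncard := by
  refine Set.ncard_congr (fun q _ => (conjSwap q.1 q.2.1 q.2.2.1 q.2.2.2, q.2)) ?_ ?_ ?_
  · exact fun q hq => conjSwap_mem_markedFuns (fun y c => Equiv.swap_apply_left c y) hq
  · rintro ⟨F, q⟩ ⟨F', q'⟩ ⟨h, -⟩ ⟨h', -⟩ e
    obtain ⟨e, e' : q = q'⟩ := Prod.mk.inj e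
    subst e'
    refine Prod.ext ?_ rfl
    exact (conjSwap_conjSwap h.mark_mem h.max.1).symm.trans
      ((congrArg (conjSwap · _ _ _) e).trans (conjSwap_conjSwap h'.mark_mem h'.max.1))
  · rintro ⟨F, q⟩ hq
    refine ⟨_, conjSwap_mem_markedFuns (fun y c => Equiv.swap_apply_right c y) hq, ?_⟩
    exact Prod.ext (conjSwap_conjSwap hq.1.mark_mem hq.1.max.1) rfl

lemma ncard_connFuns_succ (n : ℕ) {m k : ℕ} (hm : 1 ≤ m) (hk : 1 ≤ k) :
    (connFuns n m (k + 1)).ncard = (connFuns n (m + 1) k).ncard := by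
  rw [← ncard_markedFuns_max n m hk, ncard_markedFuns_comm, ncard_markedFuns_mark n k hm]

lemma ncard_connFuns (n : ℕ) {m : ℕ} (hm : 1 ≤ m) (k : ℕ) :
    (connFuns n m (k + 1)).ncard = (connFuns n (m + k) 1).ncard := by
  induction k generalizing m with
  | zero => rfl
  | succ k ih =>
    rw [ncard_connFuns_succ n hm k.succ_pos, ih m.succ_pos, Nat.succ_add_eq_add_succ]

end Endofunction

/-- The number of connected endofunctions on `{1,…,n}` of girth `m` with at least
`k` records depends only on `m + k`; in particular the number of rooted trees on
`{1,…,n}` with at least `k` records equals the number of connected endofunctions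
of girth `k`. -/
theorem stmt6 (n : ℕ) :
    (∀ m₁ k₁ m₂ k₂ : ℕ, 1 ≤ m₁ → 1 ≤ k₁ → 1 ≤ m₂ → 1 ≤ k₂ → m₁ + k₁ = m₂ + k₂ →
      Nat.card {f : Fin n → Fin n // ConnFun f ∧ girth f = m₁ ∧ k₁ ≤ numRec f} =
        Nat.card {f : Fin n → Fin n // ConnFun f ∧ girth f = m₂ ∧ k₂ ≤ numRec f}) ∧
    (∀ k : ℕ, 1 ≤ k →
      Nat.card {f : Fin n → Fin n // IsTreeFun f ∧ k ≤ numRec f} =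
        Nat.card {f : Fin n → Fin n // ConnFun f ∧ girth f = k}) := by
  have key := @Endofunction.ncard_connFuns n
  constructor
  · intro m₁ k₁ m₂ k₂ hm₁ hk₁ hm₂ hk₂ h
    obtain ⟨k₁, rfl⟩ := Nat.exists_eq_add_of_le' hk₁
    obtain ⟨k₂, rfl⟩ := Nat.exists_eq_add_of_le' hk₂
    have e : m₁ + k₁ = m₂ + k₂ := by omega
    exact (key hm₁ k₁).trans (e ▸ (key hm₂ k₂).symm)
  · intro k hk
    obtain ⟨k, rfl⟩ := Nat.exists_eq_add_of_le' hk
    have e := key le_rfl k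
    rw [add_comm 1 k] at e
    refine (Nat.card_congr (Equiv.subtypeEquivRight fun f => ?_)).trans
      (e.trans (Nat.card_congr (Equiv.subtypeEquivRight fun f => ?_)))
    · rw [Endofunction.isTreeFun_iff, and_assoc]
      rfl
    · exact ⟨fun h => ⟨h.1, h.2.1⟩, fun h => ⟨h.1, h.2, h.1.one_le_numRec⟩⟩
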